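/- arXiv:1002.4534 — 3 statements merged into one kernel-verified Lean document; each statement's English description precedes it below -/
import Mathlib

section
/- For any starting point x₀ ∈ B(x*, r) with x₀ ≠ x*, the Newton sequence x_{k+1} = x_k − F'(x_k)^{-1} F(x_k) is well defined, is contained in B(x*, r), converges to x*, and converges superlinearly: lim_{k→∞} ‖x_{k+1} − x*‖ / ‖x_k − x*‖ = 0. -/
open Filter Metric Set Topology

/-- If `B` is a two-sided inverse of `A₀` and `B A` is closer than `1` to the identity, then `A` has a
two-sided inverse. -/
theorem exists_two_sided_inverse_of_norm_comp_sub_lt_one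
    {X Y : Type*} [NormedAddCommGroup X] [NormedSpace ℝ X] [CompleteSpace X]
    [NormedAddCommGroup Y] [NormedSpace ℝ Y] {A A₀ : X →L[ℝ] Y} {B : Y →L[ℝ] X}
    (hB1 : B.comp A₀ = ContinuousLinearMap.id ℝ X)
    (hB2 : A₀.comp B = ContinuousLinearMap.id ℝ Y) (h : ‖B.comp (A - A₀)‖ < 1) :
    ∃ G : Y →L[ℝ] X, G.comp A = ContinuousLinearMap.id ℝ X ∧
      A.comp G = ContinuousLinearMap.id ℝ Y := by
  have h' : ‖-(B.comp (A - A₀))‖ < 1 := by rwa [norm_neg]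
  set u : (X →L[ℝ] X)ˣ := Units.oneSub _ h' with hu
  have huval : (u : X →L[ℝ] X) = B.comp A := by
    rw [hu, Units.val_oneSub, ContinuousLinearMap.comp_sub, hB1]
    change ContinuousLinearMap.id ℝ X - _ = _
    abel
  refine ⟨(↑u⁻¹ : X →L[ℝ] X).comp B, ?_, ?_⟩
  · rw [ContinuousLinearMap.comp_assoc, ← huval]
    exact u.inv_mul
  · have hA : A = A₀.comp (u : X →L[ℝ] X) := by
      rw [huval, ← ContinuousLinearMap.comp_assoc, hB2, ContinuousLinearMap.id_comp]
    have huu : (u : X →L[ℝ] X).comp (↑u⁻¹ : X →L[ℝ] X) = ContinuousLinearMap.id ℝ X := u.mul_inv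
    calc A.comp ((↑u⁻¹ : X →L[ℝ] X).comp B)
        = (A₀.comp (u : X →L[ℝ] X)).comp ((↑u⁻¹ : X →L[ℝ] X).comp B) := by rw [← hA]
      _ = A₀.comp (((u : X →L[ℝ] X).comp (↑u⁻¹ : X →L[ℝ] X)).comp B) := by
          simp only [ContinuousLinearMap.comp_assoc]
      _ = ContinuousLinearMap.id ℝ Y := by rw [huu, ContinuousLinearMap.id_comp, hB2]

/-- Under a majorant condition along the segment from a zero `xs` of `F` to `x`, the linearization
error of `F` is bounded by that of the majorant. -/
theorem norm_linearization_error_le_of_majorant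
    {X Y : Type*} [NormedAddCommGroup X] [NormedSpace ℝ X]
    [NormedAddCommGroup Y] [NormedSpace ℝ Y]
    {F : X → Y} {F' : X → X →L[ℝ] Y} {xs x : X} {B : Y →L[ℝ] X} {R : ℝ} {f f' : ℝ → ℝ}
    (hF : ∀ τ ∈ Icc (0:ℝ) 1, HasFDerivAt F (F' (xs + τ • (x - xs))) (xs + τ • (x - xs)))
    (hFxs : F xs = 0) (hxR : ‖x - xs‖ < R)
    (hfd : ∀ t ∈ Ico 0 R, HasDerivWithinAt f (f' t) (Ico 0 R) t) (h1 : f 0 = 0)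
    (hMH : ∀ τ ∈ Icc (0:ℝ) 1,
      ‖B.comp (F' x - F' (xs + τ • (x - xs)))‖ ≤ f' ‖x - xs‖ - f' (τ * ‖x - xs‖)) :
    ‖B (F' x (x - xs) - F x)‖ ≤ ‖x - xs‖ * f' ‖x - xs‖ - f ‖x - xs‖ := by
  set t := ‖x - xs‖ with ht
  have ht0 : 0 ≤ t := norm_nonneg _
  have hmem : ∀ τ ∈ Icc (0:ℝ) 1, τ * t ∈ Ico 0 R := fun τ hτ =>
    ⟨mul_nonneg hτ.1 ht0, (mul_le_of_le_one_left ht0 hτ.2).trans_lt hxR⟩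
  have hline : ∀ τ : ℝ, HasDerivAt (fun τ : ℝ => xs + τ • (x - xs)) (x - xs) τ := fun τ => by
    simpa using ((hasDerivAt_id τ).smul_const (x - xs)).const_add xs
  have hg : ∀ τ ∈ Icc (0:ℝ) 1,
      HasDerivAt (fun τ : ℝ => τ • B (F' x (x - xs)) - B (F (xs + τ • (x - xs))))
        (B.comp (F' x - F' (xs + τ • (x - xs))) (x - xs)) τ := fun τ hτ => by
    have h := ((hasDerivAt_id τ).smul_const (B (F' x (x - xs)))).sub
      (B.hasFDerivAt.comp_hasDerivAt τ ((hF τ hτ).comp_hasDerivAt τ (hline τ)))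
    refine h.congr_deriv ?_
    simp
  have hb : ∀ τ ∈ Icc (0:ℝ) 1,
      HasDerivWithinAt (fun τ : ℝ => τ * (t * f' t) - f (τ * t)) (t * f' t - f' (τ * t) * t)
        (Icc 0 1) τ := fun τ hτ => by
    have h := (hfd _ (hmem τ hτ)).comp τ ((hasDerivAt_id τ).mul_const t).hasDerivWithinAt hmem
    exact (((hasDerivAt_id τ).mul_const (t * f' t)).hasDerivWithinAt.sub h).congr_deriv (by simp)
  have key := image_norm_le_of_norm_deriv_right_le_deriv_boundary'
    (a := (0:ℝ)) (b := 1)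
    (fun τ hτ => (hg τ hτ).continuousAt.continuousWithinAt)
    (fun τ hτ => (hg τ (Ico_subset_Icc_self hτ)).hasDerivWithinAt)
    (B := fun τ : ℝ => τ * (t * f' t) - f (τ * t)) (by simp [hFxs, h1])
    (fun τ hτ => (hb τ hτ).continuousWithinAt)
    (fun τ hτ => (hb τ (Ico_subset_Icc_self hτ)).mono_of_mem_nhdsWithin
      (Icc_mem_nhdsGE_of_mem hτ))
    (fun τ hτ => by
      refine ((ContinuousLinearMap.le_opNorm _ _).trans (mul_le_mul_of_nonneg_right
        (hMH τ (Ico_subset_Icc_self hτ)) ht0)).trans_eq ?_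
      ring)
    (right_mem_Icc.2 zero_le_one)
  simpa using key

/-- A sequence controlled by the scalar Newton map of a majorant converges to `0`, and does so
superlinearly. -/
theorem tendsto_zero_and_superlinear_of_majorant {R : ℝ} {f f' : ℝ → ℝ}
    (hfd : ∀ t ∈ Ico 0 R, HasDerivWithinAt f (f' t) (Ico 0 R) t)
    (hf'c : ContinuousOn f' (Ico 0 R)) (h1 : f 0 = 0) (h1' : f' 0 = -1)
    {a : ℕ → ℝ} {c : ℝ} (hcR : c < R) (ha0 : ∀ k, 0 ≤ a k) (hac : ∀ k, a k ≤ c)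
    (hc : ∀ t ∈ Ioc 0 c, t * f' t - f t < t * -f' t)
    (hanti : Antitone a) (hstep : ∀ k, a (k + 1) * -f' (a k) ≤ a k * f' (a k) - f (a k)) :
    Tendsto a atTop (𝓝 0) ∧ Tendsto (fun k => a (k + 1) / a k) atTop (𝓝 0) := by
  have hmem : ∀ k, a k ∈ Ico 0 R := fun k => ⟨ha0 k, (hac k).trans_lt hcR⟩
  have hlim : Tendsto a atTop (𝓝 0) := by
    have hbdd : BddBelow (range a) := ⟨0, by rintro _ ⟨k, rfl⟩; exact ha0 k⟩
    have hL := tendsto_atTop_ciInf hanti hbdd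
    set L := ⨅ k, a k
    have hL0 : 0 ≤ L := le_ciInf ha0
    have hLc : L ≤ c := (ciInf_le hbdd 0).trans (hac 0)
    have hLR : L ∈ Ico 0 R := ⟨hL0, hLc.trans_lt hcR⟩
    have hLw : Tendsto a atTop (𝓝[Ico 0 R] L) :=
      tendsto_nhdsWithin_iff.2 ⟨hL, Eventually.of_forall hmem⟩
    have hf := (hfd L hLR).continuousWithinAt.tendsto.comp hLw
    have hf' := (hf'c L hLR).tendsto.comp hLw
    have hle := le_of_tendsto_of_tendsto' ((hL.comp (tendsto_add_atTop_nat 1)).mul hf'.neg)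
      ((hL.mul hf').sub hf) hstep
    rcases hL0.eq_or_lt with h | h
    · rwa [h]
    · exact absurd hle (hc L ⟨h, hLc⟩).not_ge
  refine ⟨hlim, ?_⟩
  have h0R : (0:ℝ) ∈ Ico 0 R := ⟨le_rfl, (hmem 0).1.trans_lt (hmem 0).2⟩
  have hw : Tendsto a atTop (𝓝[Ico 0 R] 0) :=
    tendsto_nhdsWithin_iff.2 ⟨hlim, Eventually.of_forall hmem⟩
  have hf' : Tendsto (fun k => f' (a k)) atTop (𝓝 (-1)) := by
    simpa [h1', Function.comp_def] using (hf'c 0 h0R).tendsto.comp hw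
  have hof : (fun k => f (a k) + a k) =o[atTop] a := by
    simpa [Function.comp_def, h1, h1'] using
      (hasDerivWithinAt_iff_isLittleO.1 (hfd 0 h0R)).comp_tendsto hw
  have hof' : (fun k => a k * (f' (a k) + 1)) =o[atTop] a := by
    have h : (fun k => f' (a k) + 1) =o[atTop] fun _ => (1:ℝ) := by
      rw [Asymptotics.isLittleO_one_iff]
      simpa using hf'.add_const 1
    simpa using (Asymptotics.isBigO_refl a atTop).mul_isLittleO h
  have hO : (fun k => a (k + 1)) =O[atTop]
      fun k => a k * (f' (a k) + 1) - (f (a k) + a k) := by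
    refine Asymptotics.IsBigO.of_bound 2 ?_
    filter_upwards [hf'.eventually_lt_const (show (-1:ℝ) < -1/2 by norm_num)] with k hk
    rw [Real.norm_of_nonneg (ha0 _)]
    have h2 := le_abs_self (a k * (f' (a k) + 1) - (f (a k) + a k))
    rw [Real.norm_eq_abs]
    nlinarith [hstep k, ha0 (k + 1)]
  exact (hO.trans_isLittleO (hof'.sub hof)).tendsto_div_nhds_zero

theorem stmt10
    {X Y : Type*} [NormedAddCommGroup X] [NormedSpace ℝ X] [CompleteSpace X]
    [NormedAddCommGroup Y] [NormedSpace ℝ Y] [CompleteSpace Y]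
    (Ω : Set X) (hΩ : IsOpen Ω)
    (F : X → Y) (F' : X → X →L[ℝ] Y)
    (hF : ∀ x ∈ Ω, HasFDerivAt F (F' x) x)
    (hF'c : ContinuousOn F' Ω)
    (xs : X) (hxs : xs ∈ Ω) (hFxs : F xs = 0)
    (B : Y →L[ℝ] X)
    (hB1 : B.comp (F' xs) = ContinuousLinearMap.id ℝ X)
    (hB2 : (F' xs).comp B = ContinuousLinearMap.id ℝ Y)
    (R : ℝ) (hR : 0 < R)
    (κ : ℝ) (hκ : κ = sSup {t | t ∈ Ico 0 R ∧ ball xs t ⊆ Ω})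
    (f f' : ℝ → ℝ)
    (hfd : ∀ t ∈ Ico 0 R, HasDerivWithinAt f (f' t) (Ico 0 R) t)
    (hf'c : ContinuousOn f' (Ico 0 R))
    (hMH : ∀ τ ∈ Icc (0:ℝ) 1, ∀ x ∈ ball xs κ,
      ‖B.comp (F' x - F' (xs + τ • (x - xs)))‖ ≤ f' ‖x - xs‖ - f' (τ * ‖x - xs‖))
    (h1 : f 0 = 0) (h1' : f' 0 = -1)
    (h2 : StrictMonoOn f' (Ico 0 R))
    (ν : ℝ) (hν : ν = sSup {t | t ∈ Ico 0 R ∧ f' t < 0})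
    (ρ : ℝ) (hρ : ρ = sSup {δ | δ ∈ Ioo 0 ν ∧ ∀ t ∈ Ioo 0 δ, (f t / f' t - t) / t < 1})
    (r : ℝ) (hr : r = min κ ρ)
    : ∀ x₀ ∈ ball xs r, x₀ ≠ xs →
      ∃ x : ℕ → X, x 0 = x₀ ∧
        (∀ k, ∃ G : Y →L[ℝ] X, G.comp (F' (x k)) = ContinuousLinearMap.id ℝ X ∧
          (F' (x k)).comp G = ContinuousLinearMap.id ℝ Y ∧
          x (k+1) = x k - G (F (x k))) ∧
        (∀ k, x k ∈ ball xs r) ∧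
        Tendsto x atTop (𝓝 xs) ∧
        Tendsto (fun k => ‖x (k+1) - xs‖ / ‖x k - xs‖) atTop (𝓝 0) := by
  intro x₀ hx₀ _
  rw [mem_ball, dist_eq_norm] at hx₀
  have hκ' : ∀ t, 0 ≤ t → t < κ → t < R ∧ ∀ y, ‖y - xs‖ ≤ t → y ∈ Ω := by
    intro t ht htκ
    have hne : {t | t ∈ Ico 0 R ∧ ball xs t ⊆ Ω}.Nonempty := ⟨0, by simp [hR]⟩
    obtain ⟨s, ⟨hsR, hs⟩, hts⟩ := exists_lt_of_lt_csSup hne (hκ ▸ htκ)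
    exact ⟨hts.trans hsR.2, fun y hy => hs (by rw [mem_ball, dist_eq_norm]; linarith)⟩
  have hν' : ∀ t, 0 ≤ t → t < R → t < ν → f' t < 0 := by
    intro t ht htR htν
    have hne : {t | t ∈ Ico 0 R ∧ f' t < 0}.Nonempty := ⟨0, by simp [hR, h1']⟩
    obtain ⟨s, ⟨hsR, hs⟩, hts⟩ := exists_lt_of_lt_csSup hne (hν ▸ htν)
    exact (h2 ⟨ht, htR⟩ hsR hts).trans hs
  have hρ' : ∀ t, 0 ≤ t → t < ρ → t < ν ∧ (0 < t → (f t / f' t - t) / t < 1) := by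
    intro t ht htρ
    have hne : {δ | δ ∈ Ioo 0 ν ∧ ∀ t ∈ Ioo 0 δ, (f t / f' t - t) / t < 1}.Nonempty := by
      rw [nonempty_iff_ne_empty]
      intro h
      rw [hρ, h, Real.sSup_empty] at htρ
      linarith
    obtain ⟨δ, ⟨hδν, hδ⟩, htδ⟩ := exists_lt_of_lt_csSup hne (hρ ▸ htρ)
    exact ⟨htδ.trans hδν.2, fun h => hδ t ⟨h, htδ⟩⟩
  have hdom : ∀ t, 0 ≤ t → t < r → t < R ∧ f' t < 0 := by
    intro t ht htr
    rw [hr, lt_min_iff] at htr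
    have htR := (hκ' t ht htr.1).1
    exact ⟨htR, hν' t ht htR (hρ' t ht htr.2).1⟩
  have hcontr : ∀ t, 0 < t → t < r → t * f' t - f t < t * -f' t := by
    intro t ht htr
    have hneg := (hdom t ht.le htr).2
    have h := (hρ' t ht.le (htr.trans_le (hr ▸ min_le_right _ _))).2 ht
    rw [div_lt_one ht, sub_lt_iff_lt_add, div_lt_iff_of_neg hneg] at h
    linarith
  have hstep : ∀ x ∈ ball xs r, ∃ y ∈ ball xs r, ‖y - xs‖ ≤ ‖x - xs‖ ∧
      ‖y - xs‖ * -f' ‖x - xs‖ ≤ ‖x - xs‖ * f' ‖x - xs‖ - f ‖x - xs‖ ∧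
      ∃ G : Y →L[ℝ] X, G.comp (F' x) = ContinuousLinearMap.id ℝ X ∧
        (F' x).comp G = ContinuousLinearMap.id ℝ Y ∧ y = x - G (F x) := by
    intro x hx
    rw [mem_ball, dist_eq_norm] at hx
    have ht0 := norm_nonneg (x - xs)
    obtain ⟨htR, hneg⟩ := hdom _ ht0 hx
    have hxκ : ‖x - xs‖ < κ := hx.trans_le (hr ▸ min_le_left _ _)
    have hM := fun τ hτ => hMH τ hτ x (by rwa [mem_ball, dist_eq_norm])
    have herr := norm_linearization_error_le_of_majorant (fun τ hτ => hF _ ((hκ' _ ht0 hxκ).2 _ (by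
      rw [add_sub_cancel_left, norm_smul, Real.norm_of_nonneg hτ.1]
      exact mul_le_of_le_one_left ht0 hτ.2))) hFxs htR hfd h1 hM
    have hE : ‖B.comp (F' x - F' xs)‖ ≤ f' ‖x - xs‖ + 1 := by
      simpa [h1'] using hM 0 (by simp)
    obtain ⟨G, hG1, hG2⟩ :=
      exists_two_sided_inverse_of_norm_comp_sub_lt_one hB1 hB2 (hE.trans_lt (by linarith))
    have hbound : ‖x - G (F x) - xs‖ * -f' ‖x - xs‖ ≤
        ‖x - xs‖ * f' ‖x - xs‖ - f ‖x - xs‖ := by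
      set w := x - G (F x) - xs with hw
      have hFw : F' x w = F' x (x - xs) - F x := by
        have h := DFunLike.congr_fun hG2 (F x)
        simp only [ContinuousLinearMap.comp_apply, ContinuousLinearMap.id_apply] at h
        rw [hw, sub_right_comm, map_sub, h]
      have hBw : B (F' xs w) = w := DFunLike.congr_fun hB1 w
      have hdecomp : w = B (F' x (x - xs) - F x) - B.comp (F' x - F' xs) w := by
        simp only [ContinuousLinearMap.comp_apply, sub_apply]
        rw [map_sub B (F' x w), hBw, hFw]
        abel
      have h3 : ‖w‖ ≤ ‖B (F' x (x - xs) - F x)‖ + ‖B.comp (F' x - F' xs) w‖ := by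
        conv_lhs => rw [hdecomp]
        exact norm_sub_le _ _
      have h4 := ((B.comp (F' x - F' xs)).le_opNorm w).trans
        (mul_le_mul_of_nonneg_right hE (norm_nonneg w))
      linarith
    have hle : ‖x - G (F x) - xs‖ ≤ ‖x - xs‖ := by
      refine le_of_mul_le_mul_right (hbound.trans ?_) (neg_pos.2 hneg)
      rcases ht0.eq_or_lt with h | h
      · simp [← h, h1]
      · exact (hcontr _ h hx).le
    refine ⟨x - G (F x), ?_, hle, hbound, G, hG1, hG2, rfl⟩
    rw [mem_ball, dist_eq_norm]
    exact hle.trans_lt hx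
  choose! N hNr hNle hNbound hNG using hstep
  have hmem : ∀ k, N^[k] x₀ ∈ ball xs r := by
    intro k
    induction k with
    | zero => simpa [dist_eq_norm] using hx₀
    | succ k ih => rw [Function.iterate_succ_apply']; exact hNr _ ih
  have hanti : Antitone fun k => ‖N^[k] x₀ - xs‖ := antitone_nat_of_succ_le fun k => by
    rw [Function.iterate_succ_apply']; exact hNle _ (hmem k)
  obtain ⟨hlim, hsuper⟩ := tendsto_zero_and_superlinear_of_majorant hfd hf'c h1 h1'
    (a := fun k => ‖N^[k] x₀ - xs‖) (hdom _ (norm_nonneg _) hx₀).1 (fun k => norm_nonneg _)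
    (fun k => hanti (Nat.zero_le k)) (fun t ht => hcontr t ht.1 (ht.2.trans_lt hx₀)) hanti
    (fun k => by rw [Function.iterate_succ_apply']; exact hNbound _ (hmem k))
  refine ⟨fun k => N^[k] x₀, rfl, fun k => ?_, hmem, tendsto_iff_norm_sub_tendsto_zero.2 hlim,
    hsuper⟩
  obtain ⟨G, hG1, hG2, hG3⟩ := hNG _ (hmem k)
  exact ⟨G, hG1, hG2, (Function.iterate_succ_apply' N k x₀).trans hG3⟩
end

section
/- If, for a given p with 0 < p ≤ 1, the function t ↦ (f(t)/f'(t) − t)/t^{p+1} is strictly increasing on (0, ν), then for any x₀ ∈ B(x*, r) with x₀ ≠ x*, setting t₀ = ‖x₀ − x*‖ and t₁ = |t₀ − f(t₀)/f'(t₀)|, the Newton sequence x_{k+1} = x_k − F'(x_k)^{-1} F(x_k) satisfies ‖x_k − x*‖ ≤ t₀ (t₁/t₀)^{[(p+1)^k − 1]/p} for all k = 0, 1, 2, …. -/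
open Filter Metric Set Topology

section Newton

variable {X Y : Type*} [NormedAddCommGroup X] [NormedSpace ℝ X]
  [NormedAddCommGroup Y] [NormedSpace ℝ Y]

/-- Neumann lemma: an operator `A` with `‖B (A - A₀)‖ < 1`, where `B` is the inverse of `A₀`,
has a two-sided inverse. -/
lemma exists_inverse_of_norm_comp_sub_lt_one [CompleteSpace X] {A A₀ : X →L[ℝ] Y} {B : Y →L[ℝ] X}
    (hB1 : B.comp A₀ = ContinuousLinearMap.id ℝ X)
    (hB2 : A₀.comp B = ContinuousLinearMap.id ℝ Y)
    (h : ‖B.comp (A - A₀)‖ < 1) :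
    ∃ G : Y →L[ℝ] X, G.comp A = ContinuousLinearMap.id ℝ X ∧
      A.comp G = ContinuousLinearMap.id ℝ Y := by
  have hT : ‖-(B.comp (A - A₀))‖ < 1 := by rwa [norm_neg]
  set u := Units.oneSub _ hT with hu
  have hBA : (u : X →L[ℝ] X) = B.comp A := by
    rw [hu, Units.val_oneSub, ContinuousLinearMap.comp_sub, hB1, ContinuousLinearMap.one_def]
    abel
  have hA : ∀ v, A₀ (B v) = v := fun v => by
    simpa using congrArg (fun L : Y →L[ℝ] Y => L v) hB2
  have hu1 : ∀ v, (↑u⁻¹ : X →L[ℝ] X) (B (A v)) = v := fun v => by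
    have := congrArg (fun L : X →L[ℝ] X => L v) u.inv_mul
    simpa [hBA] using this
  have hu2 : ∀ v, B (A ((↑u⁻¹ : X →L[ℝ] X) v)) = v := fun v => by
    have := congrArg (fun L : X →L[ℝ] X => L v) u.mul_inv
    simpa [hBA] using this
  refine ⟨(↑u⁻¹ : X →L[ℝ] X).comp B, ?_, ?_⟩
  · ext v
    exact hu1 v
  · ext v
    have := congrArg A₀ (hu2 (B v))
    rwa [hA, hA] at this

/-- The linearization error of `F` at `x`, evaluated at `xs`, is bounded by the one of the
scalar majorant `f`. -/
lemma norm_linearization_error_le {Ω : Set X} {F : X → Y} {F' : X → X →L[ℝ] Y}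
    (hF : ∀ x ∈ Ω, HasFDerivAt F (F' x) x) {xs : X} (hFxs : F xs = 0) (B : Y →L[ℝ] X)
    {R : ℝ} {f f' : ℝ → ℝ} (hfd : ∀ t ∈ Ico 0 R, HasDerivWithinAt f (f' t) (Ico 0 R) t)
    (h1 : f 0 = 0) {x : X} (hxR : ‖x - xs‖ < R)
    (hseg : ∀ τ ∈ Icc (0 : ℝ) 1, xs + τ • (x - xs) ∈ Ω)
    (hMH : ∀ τ ∈ Icc (0 : ℝ) 1,
      ‖B.comp (F' x - F' (xs + τ • (x - xs)))‖ ≤ f' ‖x - xs‖ - f' (τ * ‖x - xs‖)) :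
    ‖B (F' x (x - xs)) - B (F x)‖ ≤ ‖x - xs‖ * f' ‖x - xs‖ - f ‖x - xs‖ := by
  set t := ‖x - xs‖ with ht
  have ht0 : 0 ≤ t := norm_nonneg _
  have hφ : ∀ τ ∈ Icc (0 : ℝ) 1,
      HasDerivAt (fun τ : ℝ => τ • B (F' x (x - xs)) - B (F (xs + τ • (x - xs))))
        (B.comp (F' x - F' (xs + τ • (x - xs))) (x - xs)) τ := by
    intro τ hτ
    have hl : HasDerivAt (fun τ : ℝ => xs + τ • (x - xs)) (x - xs) τ := by
      simpa using ((hasDerivAt_id τ).smul_const (x - xs)).const_add xs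
    have hc := B.hasFDerivAt.comp_hasDerivAt τ ((hF _ (hseg τ hτ)).comp_hasDerivAt τ hl)
    have hs := (hasDerivAt_id τ).smul_const (B (F' x (x - xs)))
    refine (hs.sub hc).congr_deriv ?_
    simp
  have hmaps : MapsTo (fun τ : ℝ => τ * t) (Icc 0 1) (Ico 0 R) := fun τ hτ =>
    ⟨mul_nonneg hτ.1 ht0, (mul_le_of_le_one_left ht0 hτ.2).trans_lt hxR⟩
  have hψ : ∀ τ ∈ Icc (0 : ℝ) 1,
      HasDerivWithinAt (fun τ : ℝ => τ * (t * f' t) - f (τ * t))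
        (t * f' t - f' (τ * t) * t) (Icc 0 1) τ := by
    intro τ hτ
    have hl : HasDerivWithinAt (fun τ : ℝ => τ * t) t (Icc 0 1) τ := by
      simpa using ((hasDerivAt_id τ).mul_const t).hasDerivWithinAt
    have hc := (hfd _ (hmaps hτ)).comp τ hl hmaps
    have hs : HasDerivWithinAt (fun τ : ℝ => τ * (t * f' t)) (t * f' t) (Icc 0 1) τ := by
      simpa using ((hasDerivAt_id τ).mul_const (t * f' t)).hasDerivWithinAt
    exact hs.sub hc
  have hmem : ∀ τ ∈ Ico (0 : ℝ) 1, Icc (0 : ℝ) 1 ∈ 𝓝[≥] τ := fun τ hτ =>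
    Icc_mem_nhdsGE_of_mem hτ
  have key := image_norm_le_of_norm_deriv_right_le_deriv_boundary'
    (fun τ hτ => (hφ τ hτ).continuousAt.continuousWithinAt)
    (fun τ hτ => (hφ τ (Ico_subset_Icc_self hτ)).hasDerivWithinAt)
    (by simp [hFxs, h1])
    (fun τ hτ => (hψ τ hτ).continuousWithinAt)
    (fun τ hτ => (hψ τ (Ico_subset_Icc_self hτ)).mono_of_mem_nhdsWithin (hmem τ hτ))
    (fun τ hτ => ?_) (right_mem_Icc.2 zero_le_one)
  · simpa using key
  · refine (ContinuousLinearMap.le_opNorm _ _).trans ?_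
    have := mul_le_mul_of_nonneg_right (hMH τ (Ico_subset_Icc_self hτ)) ht0
    linarith

/-- One Newton step for `F` is majorized by one Newton step for the scalar function `f`. -/
lemma exists_newton_step [CompleteSpace X] {Ω : Set X} {F : X → Y} {F' : X → X →L[ℝ] Y}
    (hF : ∀ x ∈ Ω, HasFDerivAt F (F' x) x) {xs : X} (hFxs : F xs = 0) {B : Y →L[ℝ] X}
    (hB1 : B.comp (F' xs) = ContinuousLinearMap.id ℝ X)
    (hB2 : (F' xs).comp B = ContinuousLinearMap.id ℝ Y)
    {R : ℝ} {f f' : ℝ → ℝ} (hfd : ∀ t ∈ Ico 0 R, HasDerivWithinAt f (f' t) (Ico 0 R) t)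
    (h1 : f 0 = 0) (h1' : f' 0 = -1) {x : X} (hxR : ‖x - xs‖ < R)
    (hseg : ∀ τ ∈ Icc (0 : ℝ) 1, xs + τ • (x - xs) ∈ Ω)
    (hMH : ∀ τ ∈ Icc (0 : ℝ) 1,
      ‖B.comp (F' x - F' (xs + τ • (x - xs)))‖ ≤ f' ‖x - xs‖ - f' (τ * ‖x - xs‖))
    (hneg : f' ‖x - xs‖ < 0) :
    ∃ G : Y →L[ℝ] X, G.comp (F' x) = ContinuousLinearMap.id ℝ X ∧
      (F' x).comp G = ContinuousLinearMap.id ℝ Y ∧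
      ‖x - G (F x) - xs‖ ≤ f ‖x - xs‖ / f' ‖x - xs‖ - ‖x - xs‖ := by
  have hE := norm_linearization_error_le hF hFxs B hfd h1 hxR hseg hMH
  have hN : ‖B.comp (F' x - F' xs)‖ ≤ f' ‖x - xs‖ + 1 := by
    simpa [h1'] using hMH 0 (left_mem_Icc.2 zero_le_one)
  obtain ⟨G, hG1, hG2⟩ := exists_inverse_of_norm_comp_sub_lt_one hB1 hB2 (by linarith)
  refine ⟨G, hG1, hG2, ?_⟩
  set w := x - G (F x) - xs with hw
  have hBw : B (F' x w) = B (F' x (x - xs)) - B (F x) := by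
    have hFG : F' x (G (F x)) = F x := by
      simpa using congrArg (fun L : Y →L[ℝ] Y => L (F x)) hG2
    rw [hw, show x - G (F x) - xs = (x - xs) - G (F x) by abel, map_sub, hFG, map_sub]
  have hBs : B (F' xs w) = w := by
    simpa using congrArg (fun L : X →L[ℝ] X => L w) hB1
  have hdiff : ‖B (F' x w) - w‖ ≤ (f' ‖x - xs‖ + 1) * ‖w‖ := by
    have := (B.comp (F' x - F' xs)).le_of_opNorm_le hN w
    simpa [hBs] using this
  have htri : ‖w‖ ≤ ‖B (F' x w)‖ + ‖B (F' x w) - w‖ := by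
    simpa using norm_sub_le (B (F' x w)) (B (F' x w) - w)
  rw [← hBw] at hE
  have hfin : -f' ‖x - xs‖ * ‖w‖ ≤ ‖x - xs‖ * f' ‖x - xs‖ - f ‖x - xs‖ := by linarith
  rw [div_sub' hneg.ne, le_div_iff_of_neg hneg]
  linarith

end Newton

/-- A sequence of order `p + 1` obeys the explicit closed-form error bound. -/
lemma le_mul_rpow_of_superlinear {e : ℕ → ℝ} {t₀ q p : ℝ} (he : ∀ k, 0 ≤ e k) (he0 : e 0 ≤ t₀)
    (ht₀ : 0 < t₀) (hq : 0 ≤ q) (hp : 0 < p)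
    (hstep : ∀ k, e (k + 1) ≤ q * t₀ * (e k / t₀) ^ (p + 1)) (k : ℕ) :
    e k ≤ t₀ * q ^ (((p + 1) ^ k - 1) / p) := by
  induction k with
  | zero => simpa using he0
  | succ k ih =>
    set a := ((p + 1) ^ k - 1) / p with ha
    have ha0 : 0 ≤ a := div_nonneg (sub_nonneg.2 (one_le_pow₀ (by linarith))) hp.le
    have hexp : ((p + 1) ^ (k + 1) - 1) / p = 1 + a * (p + 1) := by
      rw [ha]
      field_simp
      ring
    have hdiv : e k / t₀ ≤ q ^ a := by
      rw [div_le_iff₀ ht₀]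
      linarith
    calc e (k + 1) ≤ q * t₀ * (e k / t₀) ^ (p + 1) := hstep k
      _ ≤ q * t₀ * (q ^ a) ^ (p + 1) := by
        have := div_nonneg (he k) ht₀.le
        gcongr
      _ = t₀ * q ^ (((p + 1) ^ (k + 1) - 1) / p) := by
        have hmul : 0 ≤ a * (p + 1) := by positivity
        rw [hexp, Real.rpow_add_of_nonneg hq zero_le_one hmul, Real.rpow_one, Real.rpow_mul hq]
        ring

theorem stmt12
    {X Y : Type*} [NormedAddCommGroup X] [NormedSpace ℝ X] [CompleteSpace X]
    [NormedAddCommGroup Y] [NormedSpace ℝ Y] [CompleteSpace Y]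
    (Ω : Set X) (hΩ : IsOpen Ω)
    (F : X → Y) (F' : X → X →L[ℝ] Y)
    (hF : ∀ x ∈ Ω, HasFDerivAt F (F' x) x)
    (hF'c : ContinuousOn F' Ω)
    (xs : X) (hxs : xs ∈ Ω) (hFxs : F xs = 0)
    (B : Y →L[ℝ] X)
    (hB1 : B.comp (F' xs) = ContinuousLinearMap.id ℝ X)
    (hB2 : (F' xs).comp B = ContinuousLinearMap.id ℝ Y)
    (R : ℝ) (hR : 0 < R)
    (κ : ℝ) (hκ : κ = sSup {t | t ∈ Ico 0 R ∧ ball xs t ⊆ Ω})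
    (f f' : ℝ → ℝ)
    (hfd : ∀ t ∈ Ico 0 R, HasDerivWithinAt f (f' t) (Ico 0 R) t)
    (hf'c : ContinuousOn f' (Ico 0 R))
    (hMH : ∀ τ ∈ Icc (0:ℝ) 1, ∀ x ∈ ball xs κ,
      ‖B.comp (F' x - F' (xs + τ • (x - xs)))‖ ≤ f' ‖x - xs‖ - f' (τ * ‖x - xs‖))
    (h1 : f 0 = 0) (h1' : f' 0 = -1)
    (h2 : StrictMonoOn f' (Ico 0 R))
    (ν : ℝ) (hν : ν = sSup {t | t ∈ Ico 0 R ∧ f' t < 0})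
    (ρ : ℝ) (hρ : ρ = sSup {δ | δ ∈ Ioo 0 ν ∧ ∀ t ∈ Ioo 0 δ, (f t / f' t - t) / t < 1})
    (r : ℝ) (hr : r = min κ ρ)
    (p : ℝ) (hp0 : 0 < p) (hp1 : p ≤ 1)
    (h3 : StrictMonoOn (fun t : ℝ => (f t / f' t - t) / t ^ (p+1)) (Ioo 0 ν))
    : ∀ x₀ ∈ ball xs r, x₀ ≠ xs →
      ∀ t₀ t₁ : ℝ, t₀ = ‖x₀ - xs‖ → t₁ = |t₀ - f t₀ / f' t₀| →
      ∃ x : ℕ → X, x 0 = x₀ ∧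
        (∀ k, ∃ G : Y →L[ℝ] X, G.comp (F' (x k)) = ContinuousLinearMap.id ℝ X ∧
          (F' (x k)).comp G = ContinuousLinearMap.id ℝ Y ∧
          x (k+1) = x k - G (F (x k))) ∧
        (∀ k : ℕ, ‖x k - xs‖ ≤ t₀ * (t₁ / t₀) ^ (((p+1)^k - 1) / p)) := by
  intro x₀ hx₀ hne t₀ t₁ ht₀ ht₁
  rw [mem_ball, dist_eq_norm, ← ht₀, hr, lt_min_iff] at hx₀
  obtain ⟨hκ₀, hρ₀⟩ := hx₀
  have ht₀pos : 0 < t₀ := by rw [ht₀]; exact norm_pos_iff.2 (sub_ne_zero.2 hne)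
  have hS : {δ | δ ∈ Ioo 0 ν ∧ ∀ t ∈ Ioo 0 δ, (f t / f' t - t) / t < 1}.Nonempty := by
    by_contra hS
    rw [not_nonempty_iff_eq_empty.1 hS, Real.sSup_empty] at hρ
    linarith
  obtain ⟨δ, ⟨hδν, hδ⟩, htδ⟩ := exists_lt_of_lt_csSup hS (hρ ▸ hρ₀)
  have hball : ∀ x, ‖x - xs‖ < κ → x ∈ Ω ∧ ‖x - xs‖ < R := by
    intro x hx
    obtain ⟨s, ⟨hs, hsΩ⟩, hxs'⟩ := exists_lt_of_lt_csSup ⟨0, by simpa using hR⟩ (hκ ▸ hx)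
    exact ⟨hsΩ (by rwa [mem_ball, dist_eq_norm]), hxs'.trans hs.2⟩
  have hf'neg : ∀ t, 0 ≤ t → t < ν → f' t < 0 := by
    intro t ht htν
    obtain ⟨s, ⟨hs, hs'⟩, hts⟩ :=
      exists_lt_of_lt_csSup ⟨0, by simpa [h1'] using hR⟩ (hν ▸ htν)
    exact (h2 ⟨ht, hts.trans hs.2⟩ hs hts).trans hs'
  have hnewton : ∀ x, ‖x - xs‖ ≤ t₀ → ∃ G : Y →L[ℝ] X,
      G.comp (F' x) = ContinuousLinearMap.id ℝ X ∧
      (F' x).comp G = ContinuousLinearMap.id ℝ Y ∧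
      ‖x - G (F x) - xs‖ ≤ f ‖x - xs‖ / f' ‖x - xs‖ - ‖x - xs‖ := by
    intro x hx
    have hxκ := hx.trans_lt hκ₀
    refine exists_newton_step hF hFxs hB1 hB2 hfd h1 h1' (hball x hxκ).2 (fun τ hτ => ?_)
      (fun τ hτ => hMH τ hτ x (by rwa [mem_ball, dist_eq_norm]))
      (hf'neg _ (norm_nonneg _) (hx.trans_lt (htδ.trans hδν.2)))
    refine (hball _ ?_).1
    rw [add_sub_cancel_left, norm_smul, Real.norm_of_nonneg hτ.1]
    exact (mul_le_of_le_one_left (norm_nonneg _) hτ.2).trans_lt hxκ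
  have ht₁' : t₁ = f t₀ / f' t₀ - t₀ := by
    obtain ⟨G, -, -, hG⟩ := hnewton x₀ ht₀.ge
    rw [← ht₀] at hG
    rw [ht₁, abs_sub_comm, abs_of_nonneg ((norm_nonneg _).trans hG)]
  have hq0 : 0 ≤ t₁ / t₀ := div_nonneg (ht₁ ▸ abs_nonneg _) ht₀pos.le
  have hq1 : t₁ / t₀ ≤ 1 := by rw [ht₁']; exact (hδ t₀ ⟨ht₀pos, htδ⟩).le
  have hmajor : ∀ t, 0 ≤ t → t ≤ t₀ →
      f t / f' t - t ≤ t₁ / t₀ * t₀ * (t / t₀) ^ (p + 1) := by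
    intro t ht htt
    rw [div_mul_cancel₀ _ ht₀pos.ne']
    rcases ht.eq_or_lt with rfl | htpos
    · simp [h1, Real.zero_rpow (by linarith : p + 1 ≠ 0)]
    · have hmono := h3.monotoneOn ⟨htpos, htt.trans_lt (htδ.trans hδν.2)⟩
        ⟨ht₀pos, htδ.trans hδν.2⟩ htt
      simp only [← ht₁'] at hmono
      rw [div_le_iff₀ (Real.rpow_pos_of_pos htpos _)] at hmono
      rw [Real.div_rpow ht ht₀pos.le]
      exact hmono.trans_eq (by ring)
  have hnext : ∀ x : closedBall xs t₀, ∃ y : closedBall xs t₀,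
      (∃ G : Y →L[ℝ] X, G.comp (F' x) = ContinuousLinearMap.id ℝ X ∧
        (F' x).comp G = ContinuousLinearMap.id ℝ Y ∧ (y : X) = x - G (F x)) ∧
      ‖(y : X) - xs‖ ≤ t₁ / t₀ * t₀ * (‖(x : X) - xs‖ / t₀) ^ (p + 1) := by
    rintro ⟨x, hx⟩
    rw [mem_closedBall, dist_eq_norm] at hx
    obtain ⟨G, hG1, hG2, hG⟩ := hnewton x hx
    have hy := hG.trans (hmajor _ (norm_nonneg _) hx)
    refine ⟨⟨x - G (F x), ?_⟩, ⟨G, hG1, hG2, rfl⟩, hy⟩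
    rw [mem_closedBall, dist_eq_norm]
    have hpow : (‖x - xs‖ / t₀) ^ (p + 1) ≤ 1 :=
      Real.rpow_le_one (by positivity) ((div_le_one ht₀pos).2 hx) (by linarith)
    calc _ ≤ t₁ / t₀ * t₀ * (‖x - xs‖ / t₀) ^ (p + 1) := hy
      _ ≤ 1 * t₀ * 1 := by gcongr
      _ = t₀ := by ring
  choose N hN hNle using hnext
  let z : ℕ → closedBall xs t₀ := fun k =>
    N^[k] ⟨x₀, by rw [mem_closedBall, dist_eq_norm, ← ht₀]⟩
  have hz : ∀ k, z (k + 1) = N (z k) := fun k => Function.iterate_succ_apply' _ _ _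
  refine ⟨fun k => z k, rfl, fun k => ?_, ?_⟩
  · simp only [hz]
    exact hN (z k)
  · refine le_mul_rpow_of_superlinear (e := fun k => ‖(z k : X) - xs‖)
      (fun k => norm_nonneg _) ht₀.ge ht₀pos hq0 hp0 fun k => ?_
    simp only [hz]
    exact hNle (z k)
end

section
/- Under the generalized Lipschitz condition with positive integrable L, for any starting point x₀ ∈ B(x*, r̄) with x₀ ≠ x*, the Newton sequence x_{k+1} = x_k − F'(x_k)^{-1} F(x_k) is well defined, contained in B(x*, r̄), and converges to x* with lim_{k→∞} ‖x_{k+1} − x*‖/‖x_k − x*‖ = 0; moreover, setting t₀ = ‖x₀ − x*‖, the scalar sequence t_{k+1} = (∫₀^{t_k} L(u) u du) / (1 − ∫₀^{t_k} L(u) du) is strictly decreasing, contained in (0, r̄), converges to 0 with lim_{k→∞} t_{k+1}/t_k = 0, and x* is the unique zero of F in B(x*, σ̄). -/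
open Filter Metric Set Topology

theorem exists_lt_of_lt_real_sSup {S : Set ℝ} {t : ℝ} (h0 : 0 ≤ t) (h : t < sSup S) :
    ∃ s ∈ S, t < s := by
  rcases S.eq_empty_or_nonempty with rfl | hS
  · rw [Real.sSup_empty] at h
    exact absurd h h0.not_gt
  · exact exists_lt_of_lt_csSup hS h

theorem first_moment_bounds {L : ℝ → ℝ} {a b : ℝ} (hab : a ≤ b)
    (hL : IntervalIntegrable L MeasureTheory.volume a b) (hpos : ∀ u ∈ Icc a b, 0 ≤ L u) :
    a * (∫ u in a..b, L u) ≤ ∫ u in a..b, L u * u ∧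
      ∫ u in a..b, L u * u ≤ b * ∫ u in a..b, L u := by
  have hLu : IntervalIntegrable (fun u => L u * u) MeasureTheory.volume a b :=
    hL.mul_continuousOn continuousOn_id
  rw [← intervalIntegral.integral_const_mul, ← intervalIntegral.integral_const_mul]
  constructor
  · refine intervalIntegral.integral_mono_on hab (hL.const_mul a) hLu fun u hu => ?_
    nlinarith [hpos u hu, hu.1]
  · refine intervalIntegral.integral_mono_on hab hLu (hL.const_mul b) fun u hu => ?_
    nlinarith [hpos u hu, hu.2]

/-- If `N` is squeezed like a first moment of the measure with distribution function `M`, then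
`t * M t - N t` is a right primitive of `M`. -/
theorem hasDerivWithinAt_mul_sub_moment {M N : ℝ → ℝ} {R s : ℝ} (hs : s ∈ Ico 0 R)
    (hM : ContinuousOn M (Ico 0 R))
    (hMN : ∀ a b, 0 ≤ a → a ≤ b → b < R →
      a * (M b - M a) ≤ N b - N a ∧ N b - N a ≤ b * (M b - M a)) :
    HasDerivWithinAt (fun t => t * M t - N t) (M s) (Ici s) s := by
  have hnhds : Ico s R ∈ 𝓝[Ici s] s := Ico_mem_nhdsGE hs.2
  have hMs : Tendsto M (𝓝[Ici s] s) (𝓝 (M s)) :=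
    ((hM s hs).mono (Ico_subset_Ico_left hs.1)).mono_of_mem_nhdsWithin hnhds
  rw [hasDerivWithinAt_iff_isLittleO, Asymptotics.isLittleO_iff]
  intro c hc
  filter_upwards [hnhds, hMs.eventually (eventually_le_nhds (b := M s + c) (by linarith))]
    with t ht htc
  obtain ⟨h1, h2⟩ := hMN s t hs.1 ht.1 ht.2
  have hts : 0 ≤ t - s := sub_nonneg.2 ht.1
  simp only [smul_eq_mul, Real.norm_eq_abs]
  rw [abs_of_nonneg hts, abs_of_nonneg (by nlinarith)]
  nlinarith [mul_le_mul_of_nonneg_left htc hts]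

theorem norm_comp_sub_le_of_segment {X Y Z : Type*} [NormedAddCommGroup X] [NormedSpace ℝ X]
    [NormedAddCommGroup Y] [NormedSpace ℝ Y] [NormedAddCommGroup Z] [NormedSpace ℝ Z]
    {F : X → Y} {F' : X → X →L[ℝ] Y} {x v : X} (B : Y →L[ℝ] Z) (T : X →L[ℝ] Y)
    (hF : ∀ τ ∈ Icc (0 : ℝ) 1, HasFDerivAt F (F' (x + τ • v)) (x + τ • v)) (hFx : F x = 0)
    {φ φ' : ℝ → ℝ} (hφ0 : φ 0 = 0) (hφ : ContinuousOn φ (Icc 0 1))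
    (hφ' : ∀ τ ∈ Ico (0 : ℝ) 1, HasDerivWithinAt φ (φ' τ) (Ici τ) τ)
    (hle : ∀ τ ∈ Ico (0 : ℝ) 1, ‖B.comp (F' (x + τ • v) - T)‖ * ‖v‖ ≤ φ' τ) :
    ‖B (F (x + v)) - B (T v)‖ ≤ φ 1 := by
  have hd : ∀ τ ∈ Icc (0 : ℝ) 1, HasDerivAt (fun τ : ℝ => B (F (x + τ • v)) - τ • B (T v))
      (B.comp (F' (x + τ • v) - T) v) τ := by
    intro τ hτ
    have h1 : HasDerivAt (fun τ : ℝ => x + τ • v) v τ := by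
      simpa using ((hasDerivAt_id τ).smul_const v).const_add x
    have h2 := B.hasFDerivAt.comp_hasDerivAt τ ((hF τ hτ).comp_hasDerivAt τ h1)
    have h3 := (hasDerivAt_id τ).smul_const (B (T v))
    refine (h2.sub h3).congr_deriv ?_
    simp
  have key := image_norm_le_of_norm_deriv_right_le_deriv_boundary'
    (fun τ hτ => (hd τ hτ).continuousAt.continuousWithinAt)
    (fun τ hτ => (hd τ (Ico_subset_Icc_self hτ)).hasDerivWithinAt)
    (by simp [hφ0, hFx]) hφ hφ'
    (fun τ hτ => (ContinuousLinearMap.le_opNorm _ _).trans (hle τ hτ))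
    (right_mem_Icc.2 zero_le_one)
  simpa using key

theorem exists_inverse_of_norm_id_sub_lt_one {X : Type*} [NormedAddCommGroup X] [NormedSpace ℝ X]
    [CompleteSpace X] (A : X →L[ℝ] X) {q : ℝ} (hA : ‖A - ContinuousLinearMap.id ℝ X‖ ≤ q)
    (hq : q < 1) :
    ∃ C : X →L[ℝ] X, C.comp A = ContinuousLinearMap.id ℝ X ∧
      A.comp C = ContinuousLinearMap.id ℝ X ∧ ∀ z, ‖C z‖ ≤ ‖z‖ / (1 - q) := by
  have hlt : ‖(1 : X →L[ℝ] X) - A‖ < 1 := by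
    rw [norm_sub_rev]
    exact hA.trans_lt hq
  let U := Units.oneSub (1 - A) hlt
  have hU : (U : X →L[ℝ] X) = A := by
    rw [Units.val_oneSub]
    exact sub_sub_self 1 A
  have hUl : (↑U⁻¹ : X →L[ℝ] X).comp A = ContinuousLinearMap.id ℝ X := by
    have h := U.inv_mul
    rw [hU] at h
    exact h
  have hUr : A.comp (↑U⁻¹ : X →L[ℝ] X) = ContinuousLinearMap.id ℝ X := by
    have h := U.mul_inv
    rw [hU] at h
    exact h
  refine ⟨↑U⁻¹, hUl, hUr, fun z => ?_⟩
  rw [le_div_iff₀ (by linarith)]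
  set w := (↑U⁻¹ : X →L[ℝ] X) z with hw
  have hAw : A w = z := by simpa using congrArg (fun T : X →L[ℝ] X => T z) hUr
  have h1 : ‖A w - w‖ ≤ q * ‖w‖ := by
    have h := (A - ContinuousLinearMap.id ℝ X).le_opNorm w
    exact h.trans (mul_le_mul_of_nonneg_right hA (norm_nonneg w))
  rw [hAw] at h1
  have h2 : ‖w‖ ≤ ‖z‖ + ‖z - w‖ := by
    have h := norm_sub_le z (z - w)
    rwa [sub_sub_cancel] at h
  nlinarith

/-- Superlinear convergence to `0` of nonnegative sequences dominated by the majorant iteration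
`t ↦ N t / (1 - M t)`. -/
theorem tendsto_zero_of_le_majorant {M N : ℝ → ℝ} {a : ℝ}
    (hM : ContinuousOn M (Icc 0 a)) (hN : ContinuousOn N (Icc 0 a)) (hM0 : M 0 = 0)
    (hM1 : ∀ t ∈ Icc 0 a, M t < 1) (hNM : ∀ t ∈ Icc 0 a, N t ≤ t * M t)
    (hlt : ∀ t ∈ Ioc 0 a, N t / (1 - M t) < t) {s : ℕ → ℝ} (hs0 : s 0 = a)
    (hpos : ∀ k, 0 ≤ s k) (hstep : ∀ k, s (k + 1) ≤ N (s k) / (1 - M (s k))) :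
    Tendsto s atTop (𝓝 0) ∧ Tendsto (fun k => s (k + 1) / s k) atTop (𝓝 0) := by
  have hsucc : ∀ k, s k ≤ a → s (k + 1) ≤ s k := by
    intro k hk
    rcases (hpos k).eq_or_lt with h | h
    · refine (hstep k).trans ?_
      have h0 := hNM 0 ⟨le_rfl, h ▸ hk⟩
      rw [← h, hM0]
      simpa using h0
    · exact (hstep k).trans (hlt _ ⟨h, hk⟩).le
  have hle : ∀ k, s k ≤ a := by
    intro k
    induction k with
    | zero => exact hs0.le
    | succ k ih => exact (hsucc k ih).trans ih
  have hmem : ∀ k, s k ∈ Icc 0 a := fun k => ⟨hpos k, hle k⟩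
  have hanti : Antitone s := antitone_nat_of_succ_le fun k => hsucc k (hle k)
  have hlim := tendsto_atTop_ciInf hanti ⟨0, by rintro _ ⟨k, rfl⟩; exact hpos k⟩
  set l := ⨅ k, s k
  have hl : l ∈ Icc 0 a := isClosed_Icc.mem_of_tendsto hlim (Eventually.of_forall hmem)
  have hlimW : Tendsto s atTop (𝓝[Icc 0 a] l) :=
    tendsto_nhdsWithin_iff.2 ⟨hlim, Eventually.of_forall hmem⟩
  have hMl : Tendsto (fun k => M (s k)) atTop (𝓝 (M l)) := (hM l hl).tendsto.comp hlimW
  have hNl : Tendsto (fun k => N (s k)) atTop (𝓝 (N l)) := (hN l hl).tendsto.comp hlimW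
  have hl1 : 1 - M l ≠ 0 := (sub_pos.2 (hM1 l hl)).ne'
  have hll : l ≤ N l / (1 - M l) :=
    le_of_tendsto_of_tendsto' (hlim.comp (tendsto_add_atTop_nat 1))
      (hNl.div (tendsto_const_nhds.sub hMl) hl1) hstep
  have hl0 : l = 0 := by
    by_contra h
    exact (hlt l ⟨lt_of_le_of_ne hl.1 (Ne.symm h), hl.2⟩).not_ge hll
  rw [hl0] at hlim hMl hl1
  refine ⟨hlim, squeeze_zero (fun k => div_nonneg (hpos _) (hpos _)) (fun k => ?_)
    (g := fun k => |M (s k) / (1 - M (s k))|) ?_⟩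
  · rcases (hpos k).eq_or_lt with h | h
    · simp [← h]
    · rw [div_le_iff₀ h]
      have h1 : 0 < 1 - M (s k) := sub_pos.2 (hM1 _ (hmem k))
      calc s (k + 1) ≤ N (s k) / (1 - M (s k)) := hstep k
        _ ≤ s k * M (s k) / (1 - M (s k)) := by
          gcongr
          exact hNM _ (hmem k)
        _ = M (s k) / (1 - M (s k)) * s k := by ring
        _ ≤ _ := mul_le_mul_of_nonneg_right (le_abs_self _) h.le
  · have h := (hMl.div (tendsto_const_nhds.sub hMl) hl1).abs
    simpa [hM0] using h

/-- One Newton step from a point of a ball where the majorant `M` is smaller than one. -/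
theorem exists_newton_step_s18 {X Y : Type*} [NormedAddCommGroup X] [NormedSpace ℝ X]
    [CompleteSpace X] [NormedAddCommGroup Y] [NormedSpace ℝ Y]
    {F : X → Y} {F' : X → X →L[ℝ] Y} {xs x : X} {B : Y →L[ℝ] X} {M N : ℝ → ℝ}
    (hB1 : B.comp (F' xs) = ContinuousLinearMap.id ℝ X)
    (hB2 : (F' xs).comp B = ContinuousLinearMap.id ℝ Y)
    (hop : ‖B.comp (F' x - F' xs)‖ ≤ M ‖x - xs‖) (hM1 : M ‖x - xs‖ < 1)
    (hN : ‖B (F x) - B (F' x (x - xs))‖ ≤ N ‖x - xs‖) :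
    ∃ G : Y →L[ℝ] X, G.comp (F' x) = ContinuousLinearMap.id ℝ X ∧
      (F' x).comp G = ContinuousLinearMap.id ℝ Y ∧
      ‖x - G (F x) - xs‖ ≤ N ‖x - xs‖ / (1 - M ‖x - xs‖) := by
  have hA : ‖B.comp (F' x) - ContinuousLinearMap.id ℝ X‖ ≤ M ‖x - xs‖ := by
    rwa [← hB1, ← ContinuousLinearMap.comp_sub]
  obtain ⟨C, hC1, hC2, hC⟩ := exists_inverse_of_norm_id_sub_lt_one _ hA hM1
  have e1 : ∀ z, C (B (F' x z)) = z := fun z => by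
    simpa using congrArg (fun T : X →L[ℝ] X => T z) hC1
  have e2 : ∀ z, B (F' x (C z)) = z := fun z => by
    simpa using congrArg (fun T : X →L[ℝ] X => T z) hC2
  have e3 : ∀ y, F' xs (B y) = y := fun y => by
    simpa using congrArg (fun T : Y →L[ℝ] Y => T y) hB2
  refine ⟨C.comp B, ?_, ?_, ?_⟩
  · ext z
    exact e1 z
  · ext y
    have h := congrArg (F' xs) (e2 (B y))
    rwa [e3, e3] at h
  · have h : x - C.comp B (F x) - xs = -C (B (F x) - B (F' x (x - xs))) := by
      rw [map_sub, e1]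
      simp only [ContinuousLinearMap.comp_apply]
      abel
    rw [h, norm_neg]
    refine (hC _).trans ?_
    gcongr

theorem stmt18
    {X Y : Type*} [NormedAddCommGroup X] [NormedSpace ℝ X] [CompleteSpace X]
    [NormedAddCommGroup Y] [NormedSpace ℝ Y] [CompleteSpace Y]
    (Ω : Set X) (hΩ : IsOpen Ω)
    (F : X → Y) (F' : X → X →L[ℝ] Y)
    (hF : ∀ x ∈ Ω, HasFDerivAt F (F' x) x)
    (hF'c : ContinuousOn F' Ω)
    (xs : X) (hxs : xs ∈ Ω) (hFxs : F xs = 0)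
    (B : Y →L[ℝ] X)
    (hB1 : B.comp (F' xs) = ContinuousLinearMap.id ℝ X)
    (hB2 : (F' xs).comp B = ContinuousLinearMap.id ℝ Y)
    (R : ℝ) (hR : 0 < R)
    (κ : ℝ) (hκ : κ = sSup {t | t ∈ Ico 0 R ∧ ball xs t ⊆ Ω})
    (L : ℝ → ℝ) (hLpos : ∀ t ∈ Ico (0:ℝ) R, 0 < L t)
    (hLint : MeasureTheory.IntegrableOn L (Ico 0 R))
    (hGL : ∀ τ ∈ Icc (0:ℝ) 1, ∀ x ∈ ball xs κ,
      ‖B.comp (F' x - F' (xs + τ • (x - xs)))‖ ≤ ∫ u in (τ * ‖x - xs‖)..‖x - xs‖, L u)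
    (ν : ℝ) (hν : ν = sSup {t | t ∈ Ico 0 R ∧ (∫ u in (0:ℝ)..t, L u) - 1 < 0})
    (ρ : ℝ) (hρ : ρ = sSup {δ | δ ∈ Ioo 0 ν ∧ ∀ t ∈ Ioo 0 δ,
      (∫ u in (0:ℝ)..t, L u * u) / (t * (1 - ∫ u in (0:ℝ)..t, L u)) < 1})
    (r : ℝ) (hr : r = min κ ρ)
    (σ : ℝ) (hσ : σ = sSup {t | t ∈ Ioo 0 κ ∧ (∫ u in (0:ℝ)..t, L u * (t - u)) - t < 0})
    : ∀ x₀ ∈ ball xs r, x₀ ≠ xs →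
      (∀ t : ℕ → ℝ, t 0 = ‖x₀ - xs‖ →
        (∀ k, t (k+1) = (∫ u in (0:ℝ)..t k, L u * u) / (1 - ∫ u in (0:ℝ)..t k, L u)) →
        StrictAnti t ∧ (∀ k, t k ∈ Ioo 0 r) ∧ Tendsto t atTop (𝓝 0) ∧
        Tendsto (fun k => t (k+1) / t k) atTop (𝓝 0)) ∧
      (∃ x : ℕ → X, x 0 = x₀ ∧
        (∀ k, ∃ G : Y →L[ℝ] X, G.comp (F' (x k)) = ContinuousLinearMap.id ℝ X ∧
          (F' (x k)).comp G = ContinuousLinearMap.id ℝ Y ∧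
          x (k+1) = x k - G (F (x k))) ∧
        (∀ k, x k ∈ ball xs r) ∧
        Tendsto x atTop (𝓝 xs) ∧
        Tendsto (fun k => ‖x (k+1) - xs‖ / ‖x k - xs‖) atTop (𝓝 0)) ∧
      (∀ y ∈ ball xs σ, F y = 0 → y = xs) := by
  intro x₀ hx₀ hx₀ne
  set M : ℝ → ℝ := fun t => ∫ u in (0:ℝ)..t, L u with hMdef
  set N : ℝ → ℝ := fun t => ∫ u in (0:ℝ)..t, L u * u with hNdef
  have hLR : IntervalIntegrable L MeasureTheory.volume 0 R :=
    (intervalIntegrable_iff_integrableOn_Ico_of_le hR.le).2 hLint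
  have hLuR : IntervalIntegrable (fun u => L u * u) MeasureTheory.volume 0 R :=
    hLR.mul_continuousOn continuousOn_id
  have hsub : ∀ a b, 0 ≤ a → a ≤ b → b < R → uIcc a b ⊆ uIcc 0 R := fun a b ha hab hb => by
    rw [uIcc_of_le hab, uIcc_of_le hR.le]
    exact Icc_subset_Icc ha hb.le
  have hLi : ∀ a b, 0 ≤ a → a ≤ b → b < R → IntervalIntegrable L MeasureTheory.volume a b :=
    fun a b ha hab hb => hLR.mono_set (hsub a b ha hab hb)
  have hLui : ∀ a b, 0 ≤ a → a ≤ b → b < R →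
      IntervalIntegrable (fun u => L u * u) MeasureTheory.volume a b :=
    fun a b ha hab hb => hLuR.mono_set (hsub a b ha hab hb)
  have hIco : Ico 0 R ⊆ uIcc 0 R := by
    rw [uIcc_of_le hR.le]
    exact Ico_subset_Icc_self
  have hMc : ContinuousOn M (Ico 0 R) :=
    (intervalIntegral.continuousOn_primitive_interval' hLR left_mem_uIcc).mono hIco
  have hNc : ContinuousOn N (Ico 0 R) :=
    (intervalIntegral.continuousOn_primitive_interval' hLuR left_mem_uIcc).mono hIco
  have hM0 : M 0 = 0 := intervalIntegral.integral_same
  have hN0 : N 0 = 0 := intervalIntegral.integral_same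
  have hMsub : ∀ a b, 0 ≤ a → a ≤ b → b < R → M b - M a = ∫ u in a..b, L u :=
    fun a b ha hab hb => intervalIntegral.integral_interval_sub_left
      (hLi 0 b le_rfl (ha.trans hab) hb) (hLi 0 a le_rfl ha (hab.trans_lt hb))
  have hNsub : ∀ a b, 0 ≤ a → a ≤ b → b < R → N b - N a = ∫ u in a..b, L u * u :=
    fun a b ha hab hb => intervalIntegral.integral_interval_sub_left
      (hLui 0 b le_rfl (ha.trans hab) hb) (hLui 0 a le_rfl ha (hab.trans_lt hb))
  have hMN : ∀ a b, 0 ≤ a → a ≤ b → b < R →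
      a * (M b - M a) ≤ N b - N a ∧ N b - N a ≤ b * (M b - M a) := by
    intro a b ha hab hb
    rw [hMsub a b ha hab hb, hNsub a b ha hab hb]
    exact first_moment_bounds hab (hLi a b ha hab hb)
      fun u hu => (hLpos u ⟨ha.trans hu.1, hu.2.trans_lt hb⟩).le
  have hMmono : ∀ a b, 0 ≤ a → a ≤ b → b < R → M a ≤ M b := by
    intro a b ha hab hb
    rw [← sub_nonneg, hMsub a b ha hab hb]
    exact intervalIntegral.integral_nonneg hab
      fun u hu => (hLpos u ⟨ha.trans hu.1, hu.2.trans_lt hb⟩).le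
  have hNpos : ∀ t, 0 < t → t < R → 0 < N t := fun t ht htR =>
    intervalIntegral.intervalIntegral_pos_of_pos_on (hLui 0 t le_rfl ht.le htR)
      (fun u hu => mul_pos (hLpos u ⟨hu.1.le, hu.2.trans htR⟩) hu.1) ht
  have hNle : ∀ t, 0 ≤ t → t < R → N t ≤ t * M t := fun t ht htR => by
    simpa [hM0, hN0] using (hMN 0 t le_rfl ht htR).2
  have hκlt : ∀ t, 0 ≤ t → t < κ → t < R ∧ ∀ x, ‖x - xs‖ ≤ t → x ∈ Ω := by
    intro t ht htκ
    rw [hκ] at htκ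
    obtain ⟨s, ⟨hsR, hsΩ⟩, hts⟩ := exists_lt_of_lt_real_sSup ht htκ
    exact ⟨hts.trans hsR.2, fun x hx => hsΩ (mem_ball_iff_norm.2 (hx.trans_lt hts))⟩
  have hρlt : ∀ t, 0 ≤ t → t < ρ → M t < 1 ∧ (0 < t → N t / (1 - M t) < t) := by
    intro t ht htρ
    rw [hρ] at htρ
    obtain ⟨δ, ⟨hδ, hδlt⟩, htδ⟩ := exists_lt_of_lt_real_sSup ht htρ
    have htν := htδ.trans hδ.2
    rw [hν] at htν
    obtain ⟨s, ⟨hsR, hs1⟩, hts⟩ := exists_lt_of_lt_real_sSup ht htν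
    have hM1 : M t < 1 := (hMmono t s ht hts.le hsR.2).trans_lt (sub_neg.1 hs1)
    refine ⟨hM1, fun htpos => ?_⟩
    have h := hδlt t ⟨htpos, htδ⟩
    have h1 : 0 < 1 - M t := sub_pos.2 hM1
    rw [div_lt_one (mul_pos htpos h1)] at h
    rwa [div_lt_iff₀ h1]
  have hop : ∀ x ∈ ball xs κ, ∀ τ ∈ Icc (0:ℝ) 1,
      ‖B.comp (F' x - F' (xs + τ • (x - xs)))‖ ≤ M ‖x - xs‖ - M (τ * ‖x - xs‖) := by
    intro x hx τ hτ
    rw [hMsub _ _ (mul_nonneg hτ.1 (norm_nonneg _))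
      (mul_le_of_le_one_left (norm_nonneg _) hτ.2)
      (hκlt _ (norm_nonneg _) (mem_ball_iff_norm.1 hx)).1]
    exact hGL τ hτ x hx
  have hop0 : ∀ x ∈ ball xs κ, ‖B.comp (F' x - F' xs)‖ ≤ M ‖x - xs‖ := fun x hx => by
    simpa [hM0] using hop x hx 0 ⟨le_rfl, zero_le_one⟩
  have hFseg : ∀ x ∈ ball xs κ, ∀ τ ∈ Icc (0:ℝ) 1,
      HasFDerivAt F (F' (xs + τ • (x - xs))) (xs + τ • (x - xs)) := by
    intro x hx τ hτ
    refine hF _ ((hκlt _ (norm_nonneg _) (mem_ball_iff_norm.1 hx)).2 _ ?_)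
    rw [add_sub_cancel_left, norm_smul, Real.norm_eq_abs, abs_of_nonneg hτ.1]
    exact mul_le_of_le_one_left (norm_nonneg _) hτ.2
  set D : ℝ → ℝ := fun t => t * M t - N t with hDdef
  have hDc : ContinuousOn D (Ico 0 R) := (continuousOn_id.mul hMc).sub hNc
  have hDscale : ∀ a, 0 ≤ a → a < R →
      ContinuousOn (fun τ => D (τ * a)) (Icc 0 1) ∧
      ∀ τ ∈ Ico (0:ℝ) 1, HasDerivWithinAt (fun τ => D (τ * a)) (M (τ * a) * a) (Ici τ) τ := by
    intro a ha haR
    have hmem : ∀ τ ∈ Icc (0:ℝ) 1, τ * a ∈ Ico 0 R := fun τ hτ =>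
      ⟨mul_nonneg hτ.1 ha, (mul_le_of_le_one_left ha hτ.2).trans_lt haR⟩
    refine ⟨hDc.comp (by fun_prop) hmem, fun τ hτ => ?_⟩
    have h1 := hasDerivWithinAt_mul_sub_moment (hmem τ (Ico_subset_Icc_self hτ)) hMc hMN
    have h2 : HasDerivWithinAt (fun τ : ℝ => τ * a) a (Ici τ) τ := by
      simpa using ((hasDerivAt_id τ).mul_const a).hasDerivWithinAt
    exact HasDerivWithinAt.comp τ h1 h2 fun z hz => mul_le_mul_of_nonneg_right hz ha
  have hlin : ∀ x ∈ ball xs κ, ‖B (F x) - B (F' x (x - xs))‖ ≤ N ‖x - xs‖ := by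
    intro x hx
    set a := ‖x - xs‖ with ha
    obtain ⟨hc, hd⟩ := hDscale a (norm_nonneg _)
      (hκlt _ (norm_nonneg _) (mem_ball_iff_norm.1 hx)).1
    have h := norm_comp_sub_le_of_segment (φ := fun τ => τ * (M a * a) - D (τ * a))
      (φ' := fun τ => M a * a - M (τ * a) * a) B (F' x) (hFseg x hx) hFxs
      (by simp [hDdef, hN0]) ((by fun_prop : ContinuousOn _ _).sub hc)
      (fun τ hτ => by
        have h1 : HasDerivWithinAt (fun τ : ℝ => τ * (M a * a)) (M a * a) (Ici τ) τ := by
          simpa using ((hasDerivAt_id τ).mul_const (M a * a)).hasDerivWithinAt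
        exact h1.sub (hd τ hτ))
      (fun τ hτ => by
        rw [← sub_mul, ← norm_neg, ← ContinuousLinearMap.comp_neg, neg_sub]
        exact mul_le_mul_of_nonneg_right (hop x hx τ (Ico_subset_Icc_self hτ)) (norm_nonneg _))
    rw [add_sub_cancel] at h
    refine h.trans_eq ?_
    simp only [hDdef, one_mul]
    ring
  have hrκ : ∀ t, t < r → t < κ := fun t ht => ht.trans_le (hr ▸ min_le_left _ _)
  have hrρ : ∀ t, t < r → t < ρ := fun t ht => ht.trans_le (hr ▸ min_le_right _ _)
  have ha0 : 0 < ‖x₀ - xs‖ := norm_pos_iff.2 (sub_ne_zero.2 hx₀ne)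
  have har : ‖x₀ - xs‖ < r := mem_ball_iff_norm.1 hx₀
  have haR := (hκlt _ ha0.le (hrκ _ har)).1
  have hIcc : Icc 0 ‖x₀ - xs‖ ⊆ Ico 0 R := fun t ht => ⟨ht.1, ht.2.trans_lt haR⟩
  have hseq := fun (s : ℕ → ℝ) => tendsto_zero_of_le_majorant (s := s) (hMc.mono hIcc)
    (hNc.mono hIcc) hM0 (fun t ht => (hρlt t ht.1 (hrρ _ (ht.2.trans_lt har))).1)
    (fun t ht => hNle t ht.1 (ht.2.trans_lt haR))
    (fun t ht => (hρlt t ht.1.le (hrρ _ (ht.2.trans_lt har))).2 ht.1)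
  refine ⟨?_, ?_, ?_⟩
  · intro t ht0 ht
    have hmem : ∀ k, t k ∈ Ioo 0 r := by
      intro k
      induction k with
      | zero => exact ht0 ▸ ⟨ha0, har⟩
      | succ k ih =>
        obtain ⟨h1, h2⟩ := hρlt _ ih.1.le (hrρ _ ih.2)
        rw [ht k]
        exact ⟨div_pos (hNpos _ ih.1 (hκlt _ ih.1.le (hrκ _ ih.2)).1) (sub_pos.2 h1),
          (h2 ih.1).trans ih.2⟩
    obtain ⟨hl, hq⟩ := hseq t ht0 (fun k => (hmem k).1.le) (fun k => (ht k).le)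
    refine ⟨strictAnti_nat_of_succ_lt fun k => ?_, hmem, hl, hq⟩
    rw [ht k]
    exact (hρlt _ (hmem k).1.le (hrρ _ (hmem k).2)).2 (hmem k).1
  · have hstep : ∀ x : ball xs r, ∃ x' : ball xs r, (∃ G : Y →L[ℝ] X,
        G.comp (F' x) = ContinuousLinearMap.id ℝ X ∧
        (F' x).comp G = ContinuousLinearMap.id ℝ Y ∧ (x' : X) = x - G (F x)) ∧
        ‖(x' : X) - xs‖ ≤ N ‖(x : X) - xs‖ / (1 - M ‖(x : X) - xs‖) := by
      rintro ⟨x, hx⟩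
      have hxr := mem_ball_iff_norm.1 hx
      have hxκ : x ∈ ball xs κ := mem_ball_iff_norm.2 (hrκ _ hxr)
      obtain ⟨h1, h2⟩ := hρlt _ (norm_nonneg _) (hrρ _ hxr)
      obtain ⟨G, hG1, hG2, hG⟩ := exists_newton_step_s18 hB1 hB2 (hop0 x hxκ) h1 (hlin x hxκ)
      refine ⟨⟨x - G (F x), mem_ball_iff_norm.2 (hG.trans_lt ?_)⟩, ⟨G, hG1, hG2, rfl⟩, hG⟩
      rcases (norm_nonneg (x - xs)).eq_or_lt with h | h
      · rw [← h, hN0, zero_div]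
        exact ha0.trans har
      · exact (h2 h).trans hxr
    choose g hg hgle using hstep
    let z : ℕ → ball xs r := fun k => Nat.rec ⟨x₀, hx₀⟩ (fun _ x => g x) k
    let d : ℕ → ℝ := fun k => ‖(z k).1 - xs‖
    have hd : ∀ k, d (k + 1) ≤ N (d k) / (1 - M (d k)) := fun k => hgle (z k)
    obtain ⟨hl, hq⟩ := hseq d rfl (fun k => norm_nonneg _) hd
    exact ⟨fun k => (z k).1, rfl, fun k => hg (z k), fun k => (z k).2,
      tendsto_iff_norm_sub_tendsto_zero.2 hl, hq⟩
  · intro y hy hFy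
    set a := ‖y - xs‖ with ha
    have hyσ : a < σ := mem_ball_iff_norm.1 hy
    rw [hσ] at hyσ
    obtain ⟨s, ⟨hs, hs0⟩, has⟩ := exists_lt_of_lt_real_sSup (norm_nonneg _) hyσ
    have hsR := (hκlt s hs.1.le hs.2).1
    have hyκ : y ∈ ball xs κ := mem_ball_iff_norm.2 (has.trans hs.2)
    have haR' := has.trans hsR
    have hDs : D s < s := by
      have h : ∫ u in (0:ℝ)..s, L u * (s - u) = D s := by
        simp only [hDdef, hMdef, hNdef]
        rw [← intervalIntegral.integral_const_mul,
          ← intervalIntegral.integral_sub ((hLi 0 s le_rfl hs.1.le hsR).const_mul s)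
            (hLui 0 s le_rfl hs.1.le hsR)]
        exact intervalIntegral.integral_congr fun u _ => by ring
      rw [h] at hs0
      linarith
    obtain ⟨hc, hd⟩ := hDscale a (norm_nonneg _) haR'
    have h := norm_comp_sub_le_of_segment (φ := fun τ => D (τ * a))
      (φ' := fun τ => M (τ * a) * a) B (F' xs) (hFseg y hyκ) hFxs
      (by simp [hDdef, hN0]) hc hd
      (fun τ hτ => by
        have hn : ‖xs + τ • (y - xs) - xs‖ = τ * a := by
          rw [add_sub_cancel_left, norm_smul, Real.norm_eq_abs, abs_of_nonneg hτ.1]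
        have hm : xs + τ • (y - xs) ∈ ball xs κ := by
          rw [mem_ball_iff_norm, hn]
          exact (mul_le_of_le_one_left (norm_nonneg _) hτ.2.le).trans_lt (has.trans hs.2)
        have h1 := hop0 _ hm
        rw [hn] at h1
        exact mul_le_mul_of_nonneg_right h1 (norm_nonneg _))
    have hBF : B (F' xs (y - xs)) = y - xs := by
      simpa using congrArg (fun T : X →L[ℝ] X => T (y - xs)) hB1
    rw [add_sub_cancel, hFy, hBF, map_zero, zero_sub, norm_neg, one_mul] at h
    by_contra hne
    have ha0' : 0 < a := norm_pos_iff.2 (sub_ne_zero.2 hne)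
    have hNa := hNle a ha0'.le haR'
    have hbd := (hMN a s ha0'.le has.le hsR).2
    have hmm := hMmono a s ha0'.le has.le hsR
    have hdiff : (s - a) * M a ≤ D s - D a := by
      simp only [hDdef]
      nlinarith
    have h1 : 1 ≤ M a := by
      by_contra hlt
      have hNa0 := hNpos a ha0' haR'
      have h' : a ≤ a * M a - N a := h
      nlinarith
    have h' : a ≤ D a := h
    nlinarith
end
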